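/- Let A₁ ⊆ A₂ and B be hermitian-closed unital subalgebras of M_d(ℂ). Then S(A₁:B) ≤ S(A₂:B). -/

import Mathlib

open MeasureTheory Matrix Kronecker

noncomputable section

instance matMeasurableSpace (n : Type*) [Fintype n] : MeasurableSpace (Matrix n n ℂ) :=
  show MeasurableSpace (n → n → ℂ) from inferInstance

/-- Squared Frobenius (Hilbert-Schmidt) norm `‖X‖₂² = Tr(X† X)`. -/
def hs2 {n : Type*} [Fintype n] (X : Matrix n n ℂ) : ℝ := (Matrix.trace (Xᴴ * X)).re

/-- Mutual Averaged Non-commutativity: `(1/(2d)) ∫∫ ‖UV - VU‖₂² dμ(U) dν(V)`,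
where `μ`, `ν` are meant to be the normalized Haar measures of the unitary groups of
the two algebras (imposed by the `IsHaar` hypotheses in the theorems below). -/
def MAN {n : Type*} [Fintype n] (μ ν : Measure (Matrix n n ℂ)) : ℝ :=
  (1 / (2 * (Fintype.card n : ℝ))) * ∫ U, ∫ V, hs2 (U * V - V * U) ∂ν ∂μ

/-- `μ` is the normalized Haar probability measure of the compact unitary group
`U(A) = {U ∈ A : U†U = UU† = 1}` of the star-subalgebra `A`, viewed as a measure on
matrix space concentrated on `U(A)` and invariant under left translation by `U(A)`. -/
def IsHaar {n : Type*} [Fintype n] [DecidableEq n] (A : StarSubalgebra ℂ (Matrix n n ℂ))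
    (μ : Measure (Matrix n n ℂ)) : Prop :=
  IsProbabilityMeasure μ ∧
  μ {U | ¬ (U ∈ A ∧ U ∈ unitary (Matrix n n ℂ))} = 0 ∧
  ∀ U ∈ A, U ∈ unitary (Matrix n n ℂ) → μ.map (fun V => U * V) = μ

attribute [local instance] Matrix.normedAddCommGroup Matrix.normedSpace

section MatrixMeasure

variable {n : Type*} [Fintype n]

instance matBorelSpace : BorelSpace (Matrix n n ℂ) :=
  show BorelSpace (n → n → ℂ) from inferInstance

instance matSecondCountableTopology : SecondCountableTopology (Matrix n n ℂ) :=
  show SecondCountableTopology (n → n → ℂ) from inferInstance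

/-- The real part of the Hilbert-Schmidt inner product. -/
def hsInner (X Y : Matrix n n ℂ) : ℝ := (Matrix.trace (Xᴴ * Y)).re

theorem hsInner_comm (X Y : Matrix n n ℂ) : hsInner X Y = hsInner Y X := by
  unfold hsInner
  rw [← Complex.conj_re, starRingEnd_apply, ← trace_conjTranspose, conjTranspose_mul,
    conjTranspose_conjTranspose]

theorem hs2_sub (X Y : Matrix n n ℂ) : hs2 (X - Y) = hs2 X + hs2 Y - 2 * hsInner X Y := by
  have h := hsInner_comm X Y
  simp only [hsInner, hs2, conjTranspose_sub, sub_mul, mul_sub, trace_sub, Complex.sub_re] at h ⊢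
  linarith

open scoped ComplexOrder in
theorem hs2_nonneg (X : Matrix n n ℂ) : 0 ≤ hs2 X :=
  (Complex.le_def.1 (posSemidef_conjTranspose_mul_self X).trace_nonneg).1

/-- `hsInner X` as a continuous linear functional. -/
def hsInnerCLM (X : Matrix n n ℂ) : Matrix n n ℂ →L[ℝ] ℝ where
  toFun := hsInner X
  map_add' Y Z := by simp [hsInner, mul_add]
  map_smul' c Y := by simp [hsInner]
  cont := by unfold hsInner; fun_prop

/-- The average of `U X U†` over `U` distributed according to `μ`. -/
def twirl (μ : Measure (Matrix n n ℂ)) (X : Matrix n n ℂ) : Matrix n n ℂ :=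
  ∫ U, U * X * Uᴴ ∂μ

variable [DecidableEq n]

theorem isCompact_unitary_matrix :
    IsCompact (unitary (Matrix n n ℂ) : Set (Matrix n n ℂ)) := by
  have : ProperSpace (Matrix n n ℂ) := inferInstanceAs (ProperSpace (n → n → ℂ))
  refine Metric.isCompact_of_isClosed_isBounded ?_ ?_
  · have h : (unitary (Matrix n n ℂ) : Set (Matrix n n ℂ)) =
        {U | Uᴴ * U = 1} ∩ {U | U * Uᴴ = 1} := by
      ext U
      simp [Unitary.mem_iff, star_eq_conjTranspose]
    rw [h]
    exact (isClosed_eq (by fun_prop) continuous_const).inter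
      (isClosed_eq (by fun_prop) continuous_const)
  · refine (Metric.isBounded_closedBall (x := (0 : Matrix n n ℂ)) (r := 1)).subset ?_
    intro U hU
    rw [mem_closedBall_zero_iff, Matrix.norm_le_iff zero_le_one]
    exact fun i j => entry_norm_bound_of_unitary hU i j

/-- For unitary `U`, the commutator with `U` has the norm of `V - U V U†`. -/
theorem hs2_commutator {U : Matrix n n ℂ} (hU : U ∈ unitary (Matrix n n ℂ)) (V : Matrix n n ℂ) :
    hs2 (U * V - V * U) = 2 * hs2 V - 2 * hsInner V (U * V * Uᴴ) := by
  have h1 : Uᴴ * U = 1 := (Unitary.mem_iff.1 hU).1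
  have h2 : U * Uᴴ = 1 := (Unitary.mem_iff.1 hU).2
  have hUV : hs2 (U * V) = hs2 V := by
    unfold hs2
    rw [conjTranspose_mul, Matrix.mul_assoc, ← Matrix.mul_assoc Uᴴ, h1, Matrix.one_mul]
  have hVU : hs2 (V * U) = hs2 V := by
    unfold hs2
    rw [conjTranspose_mul, Matrix.mul_assoc, trace_mul_comm, Matrix.mul_assoc, Matrix.mul_assoc,
      h2, Matrix.mul_one]
  have hc : hsInner (V * U) (U * V) = hsInner V (U * V * Uᴴ) := by
    unfold hsInner
    rw [conjTranspose_mul, Matrix.mul_assoc, trace_mul_comm, Matrix.mul_assoc]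
  rw [hs2_sub, hUV, hVU, hsInner_comm, hc]
  ring

theorem hsInner_conj {U Y : Matrix n n ℂ} (hU : U ∈ unitary (Matrix n n ℂ))
    (hY : U * Y * Uᴴ = Y) (X : Matrix n n ℂ) :
    hsInner Y (U * X * Uᴴ) = hsInner Y X := by
  have h1 : Uᴴ * U = 1 := (Unitary.mem_iff.1 hU).1
  have hY' : Uᴴ * Yᴴ * U = Yᴴ := by
    nth_rewrite 1 [← hY]
    simp only [conjTranspose_mul, conjTranspose_conjTranspose, Matrix.mul_assoc, h1,
      Matrix.mul_one]
    rw [← Matrix.mul_assoc, h1, Matrix.one_mul]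
  unfold hsInner
  rw [← Matrix.mul_assoc, trace_mul_comm, ← Matrix.mul_assoc, ← Matrix.mul_assoc, hY']

namespace IsHaar

variable {A B : StarSubalgebra ℂ (Matrix n n ℂ)} {μ ν : Measure (Matrix n n ℂ)}

theorem ae_mem (h : IsHaar A μ) : ∀ᵐ U ∂μ, U ∈ A ∧ U ∈ unitary (Matrix n n ℂ) :=
  ae_iff.2 h.2.1

theorem restrict_unitary (h : IsHaar A μ) :
    μ.restrict (unitary (Matrix n n ℂ) : Set (Matrix n n ℂ)) = μ :=
  Measure.restrict_eq_self_of_ae_mem (h.ae_mem.mono fun _ hU => hU.2)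

theorem integrable {E : Type*} [NormedAddCommGroup E] [SecondCountableTopology E]
    (h : IsHaar A μ) {f : Matrix n n ℂ → E} (hf : Continuous f) : Integrable f μ := by
  have := h.1
  rw [← h.restrict_unitary]
  exact hf.continuousOn.integrableOn_compact isCompact_unitary_matrix

theorem integrable_prod (hμ : IsHaar A μ) (hν : IsHaar B ν)
    {f : Matrix n n ℂ × Matrix n n ℂ → ℝ} (hf : Continuous f) : Integrable f (μ.prod ν) := by
  have := hμ.1
  have := hν.1
  rw [← hμ.restrict_unitary, ← hν.restrict_unitary, Measure.prod_restrict]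
  exact hf.continuousOn.integrableOn_compact
    (isCompact_unitary_matrix.prod isCompact_unitary_matrix)

theorem hsInner_twirl (h : IsHaar A μ) (X Y : Matrix n n ℂ) :
    hsInner Y (twirl μ X) = ∫ U, hsInner Y (U * X * Uᴴ) ∂μ :=
  ((hsInnerCLM Y).integral_comp_comm (h.integrable (by fun_prop))).symm

theorem conj_twirl (h : IsHaar A μ) {W : Matrix n n ℂ} (hW : W ∈ A)
    (hWu : W ∈ unitary (Matrix n n ℂ)) (X : Matrix n n ℂ) :
    W * twirl μ X * Wᴴ = twirl μ X := by
  let L : Matrix n n ℂ →L[ℝ] Matrix n n ℂ :=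
    { toFun := fun Y => W * Y * Wᴴ
      map_add' := fun Y Z => by simp [mul_add, add_mul]
      map_smul' := fun c Y => by simp
      cont := by fun_prop }
  calc W * twirl μ X * Wᴴ = L (twirl μ X) := rfl
    _ = ∫ U, L (U * X * Uᴴ) ∂μ := (L.integral_comp_comm (h.integrable (by fun_prop))).symm
    _ = ∫ U, (W * U) * X * (W * U)ᴴ ∂μ := by
      refine integral_congr_ae (.of_forall fun U => ?_)
      change W * (U * X * Uᴴ) * Wᴴ = _
      simp only [conjTranspose_mul, Matrix.mul_assoc]
    _ = ∫ U, U * X * Uᴴ ∂(μ.map fun V => W * V) := by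
      rw [integral_map]
      · exact (Continuous.measurable (by fun_prop)).aemeasurable
      · exact Continuous.aestronglyMeasurable (by fun_prop)
    _ = twirl μ X := by rw [h.2.2 W hW hWu]; rfl

theorem hsInner_twirl_of_conj_eq (h : IsHaar A μ) {Y : Matrix n n ℂ}
    (hY : ∀ W ∈ A, W ∈ unitary (Matrix n n ℂ) → W * Y * Wᴴ = Y) (X : Matrix n n ℂ) :
    hsInner Y (twirl μ X) = hsInner Y X := by
  have := h.1
  rw [h.hsInner_twirl, integral_congr_ae (g := fun _ => hsInner Y X)]
  · simp
  · filter_upwards [h.ae_mem] with U hU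
    exact hsInner_conj hU.2 (hY U hU.1 hU.2) X

theorem hsInner_self_twirl (h : IsHaar A μ) (X : Matrix n n ℂ) :
    hsInner X (twirl μ X) = hs2 (twirl μ X) := by
  rw [hsInner_comm, ← h.hsInner_twirl_of_conj_eq (fun W hW hWu => h.conj_twirl hW hWu X)]
  rfl

/-- Twirling over a larger unitary group projects onto a smaller commutant. -/
theorem hs2_twirl_anti (hAB : A ≤ B) (hμ : IsHaar A μ) (hν : IsHaar B ν) (X : Matrix n n ℂ) :
    hs2 (twirl ν X) ≤ hs2 (twirl μ X) := by
  have h1 : hsInner (twirl ν X) (twirl μ X) = hs2 (twirl ν X) := by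
    rw [hμ.hsInner_twirl_of_conj_eq fun W hW hWu => hν.conj_twirl (hAB hW) hWu X, hsInner_comm,
      hν.hsInner_self_twirl]
  have h2 := hs2_nonneg (twirl ν X - twirl μ X)
  rw [hs2_sub, h1] at h2
  linarith

theorem integral_hs2_commutator (h : IsHaar A μ) (V : Matrix n n ℂ) :
    ∫ U, hs2 (U * V - V * U) ∂μ = 2 * hs2 V - 2 * hs2 (twirl μ V) := by
  have := h.1
  have hc : Continuous fun U : Matrix n n ℂ => hsInner V (U * V * Uᴴ) :=
    (hsInnerCLM V).continuous.comp (by fun_prop)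
  rw [integral_congr_ae (h.ae_mem.mono fun U hU => hs2_commutator hU.2 V),
    integral_sub (integrable_const _) ((h.integrable hc).const_mul 2),
    integral_const_mul 2 fun U => hsInner V (U * V * Uᴴ), ← h.hsInner_twirl, h.hsInner_self_twirl]
  simp

theorem integrable_prod_hs2_commutator (hμ : IsHaar A μ) (hν : IsHaar B ν) :
    Integrable (fun p : Matrix n n ℂ × Matrix n n ℂ => hs2 (p.1 * p.2 - p.2 * p.1))
      (μ.prod ν) :=
  hμ.integrable_prod hν (by unfold hs2; fun_prop)

theorem integrable_hs2_sub_hs2_twirl (hμ : IsHaar A μ) (hν : IsHaar B ν) :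
    Integrable (fun V => 2 * hs2 V - 2 * hs2 (twirl μ V)) ν := by
  have := hμ.1
  have := hν.1
  simp_rw [← hμ.integral_hs2_commutator]
  exact (hμ.integrable_prod_hs2_commutator hν).integral_prod_right

theorem man_eq (hμ : IsHaar A μ) (hν : IsHaar B ν) :
    MAN μ ν = 1 / (2 * (Fintype.card n : ℝ)) * ∫ V, (2 * hs2 V - 2 * hs2 (twirl μ V)) ∂ν := by
  have := hμ.1
  have := hν.1
  simp_rw [← hμ.integral_hs2_commutator]
  unfold MAN
  rw [integral_integral_swap (hμ.integrable_prod_hs2_commutator hν)]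

end IsHaar

end MatrixMeasure

/-- Monotonicity of MAN: `A₁ ⊆ A₂ ⟹ S(A₁:B) ≤ S(A₂:B)`. -/
theorem stmt_5 (d : ℕ) (hd : 0 < d)
    (A₁ A₂ B : StarSubalgebra ℂ (Matrix (Fin d) (Fin d) ℂ)) (hA : A₁ ≤ A₂)
    (μ₁ μ₂ ν : Measure (Matrix (Fin d) (Fin d) ℂ))
    (h₁ : IsHaar A₁ μ₁) (h₂ : IsHaar A₂ μ₂) (hν : IsHaar B ν) :
    MAN μ₁ ν ≤ MAN μ₂ ν := by
  rw [h₁.man_eq hν, h₂.man_eq hν]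
  refine mul_le_mul_of_nonneg_left ?_ (by positivity)
  refine integral_mono (h₁.integrable_hs2_sub_hs2_twirl hν)
    (h₂.integrable_hs2_sub_hs2_twirl hν) fun V => ?_
  linarith [h₁.hs2_twirl_anti hA h₂ V]
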